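/- arXiv:math/0408091 — 2 statements merged into one kernel-verified Lean document; each statement's English description precedes it below -/
import Mathlib

section
/- Let Pr > 0, let F : [0,1] → ℝ be continuous, and let S, ψ : [0,∞) × ℝ² → ℝ be smooth in all variables, with ψ(t,x,z) = 0 for all t ≥ 0 and (x,z) ∈ ∂D, and with ∂ₓS(t,0,z) = F(z), ∂ₓS(t,1,z) = 0, ∂_zS(t,x,0) = ∂_zS(t,x,1) = 0 for all t ≥ 0, x,z ∈ [0,1]. Suppose ∂_tS + J(S(t,·), ψ(t,·)) = (1/Pr) ΔS(t,·) on D for every t ≥ 0. Then for every t ≥ 0, (d/dt) ∫_D S(t,x,z)² d(x,z) = −(2/Pr) ∫_D |∇S(t,x,z)|² d(x,z) − (2/Pr) ∫₀¹ F(z) · S(t,0,z) dz. -/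
open MeasureTheory

/-- The closed unit square `[0,1] × [0,1]` in `ℝ²`. -/
def unitSq : Set (ℝ × ℝ) := (Set.Icc (0:ℝ) 1) ×ˢ (Set.Icc (0:ℝ) 1)

/-- Partial derivative in the first (`x`) direction. -/
noncomputable def pdx (f : ℝ × ℝ → ℝ) (p : ℝ × ℝ) : ℝ := fderiv ℝ f p (1, 0)

/-- Partial derivative in the second (`z`) direction. -/
noncomputable def pdz (f : ℝ × ℝ → ℝ) (p : ℝ × ℝ) : ℝ := fderiv ℝ f p (0, 1)

/-- The Jacobian operator `J(g,h) = ∂ₓg ∂_z h − ∂_z g ∂ₓ h`. -/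
noncomputable def Jac (g h : ℝ × ℝ → ℝ) (p : ℝ × ℝ) : ℝ :=
  pdx g p * pdz h p - pdz g p * pdx h p

/-- The Laplacian `Δ = ∂ₓₓ + ∂_zz`. -/
noncomputable def lap (f : ℝ × ℝ → ℝ) (p : ℝ × ℝ) : ℝ := pdx (pdx f) p + pdz (pdz f) p

/-- `f : ℝ → ℝ × ℝ → ℝ` is jointly smooth in time and space. -/
def JointlySmooth (f : ℝ → ℝ × ℝ → ℝ) : Prop :=
  ContDiff ℝ (⊤ : ℕ∞) (fun q : ℝ × (ℝ × ℝ) => f q.1 q.2)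

section Calculus

variable {f g : ℝ × ℝ → ℝ}

theorem ContDiff.pdx (hf : ContDiff ℝ (⊤ : ℕ∞) f) : ContDiff ℝ (⊤ : ℕ∞) (pdx f) :=
  (hf.fderiv_right (m := (⊤ : ℕ∞)) (by simp)).clm_apply contDiff_const

theorem ContDiff.pdz (hf : ContDiff ℝ (⊤ : ℕ∞) f) : ContDiff ℝ (⊤ : ℕ∞) (pdz f) :=
  (hf.fderiv_right (m := (⊤ : ℕ∞)) (by simp)).clm_apply contDiff_const

theorem pdx_mul (hf : Differentiable ℝ f) (hg : Differentiable ℝ g) (p : ℝ × ℝ) :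
    pdx (fun q => f q * g q) p = f p * pdx g p + pdx f p * g p := by
  simp [pdx, fderiv_fun_mul (hf p) (hg p), mul_comm]

theorem pdz_mul (hf : Differentiable ℝ f) (hg : Differentiable ℝ g) (p : ℝ × ℝ) :
    pdz (fun q => f q * g q) p = f p * pdz g p + pdz f p * g p := by
  simp [pdz, fderiv_fun_mul (hf p) (hg p), mul_comm]

theorem pdx_add (hf : Differentiable ℝ f) (hg : Differentiable ℝ g) (p : ℝ × ℝ) :
    pdx (fun q => f q + g q) p = pdx f p + pdx g p := by
  simp [pdx, fderiv_fun_add (hf p) (hg p)]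

theorem pdz_sub (hf : Differentiable ℝ f) (hg : Differentiable ℝ g) (p : ℝ × ℝ) :
    pdz (fun q => f q - g q) p = pdz f p - pdz g p := by
  simp [pdz, fderiv_fun_sub (hf p) (hg p)]

theorem pdx_const_mul (c : ℝ) (hf : Differentiable ℝ f) (p : ℝ × ℝ) :
    pdx (fun q => c * f q) p = c * pdx f p := by
  simp [pdx, fderiv_const_mul (hf p)]

theorem pdz_const_mul (c : ℝ) (hf : Differentiable ℝ f) (p : ℝ × ℝ) :
    pdz (fun q => c * f q) p = c * pdz f p := by
  simp [pdz, fderiv_const_mul (hf p)]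

/-- Mixed partial derivatives of a smooth function commute. -/
theorem pdx_pdz_comm (hf : ContDiff ℝ (⊤ : ℕ∞) f) (p : ℝ × ℝ) :
    pdx (pdz f) p = pdz (pdx f) p := by
  have hd : DifferentiableAt ℝ (fderiv ℝ f) p :=
    (hf.fderiv_right (m := (⊤ : ℕ∞)) (by simp)).differentiable (by simp) p
  have hsymm : IsSymmSndFDerivAt ℝ f p :=
    hf.contDiffAt.isSymmSndFDerivAt (by simpa using WithTop.coe_le_coe.2 (le_top : (2 : ℕ∞) ≤ ⊤))
  have hx : pdx (pdz f) p = fderiv ℝ (fderiv ℝ f) p (1, 0) (0, 1) := by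
    change fderiv ℝ (fun q => fderiv ℝ f q (0, 1)) p (1, 0) = _
    simp [fderiv_clm_apply hd (differentiableAt_const _)]
  have hz : pdz (pdx f) p = fderiv ℝ (fderiv ℝ f) p (0, 1) (1, 0) := by
    change fderiv ℝ (fun q => fderiv ℝ f q (1, 0)) p (0, 1) = _
    simp [fderiv_clm_apply hd (differentiableAt_const _)]
  rw [hx, hz]
  exact hsymm _ _

end Calculus

theorem unitSq_eq_Icc : unitSq = Set.Icc ((0 : ℝ), (0 : ℝ)) (1, 1) :=
  Set.Icc_prod_Icc _ _ _ _

theorem isCompact_unitSq : IsCompact unitSq := isCompact_Icc.prod isCompact_Icc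

theorem mem_frontier_unitSq {p : ℝ × ℝ} (hp : p ∈ unitSq)
    (h : (p.1 = 0 ∨ p.1 = 1) ∨ p.2 = 0 ∨ p.2 = 1) : p ∈ frontier unitSq := by
  rw [isCompact_unitSq.isClosed.frontier_eq]
  refine ⟨hp, fun hi => ?_⟩
  rw [unitSq, interior_prod_eq, interior_Icc] at hi
  obtain ⟨⟨h1, h2⟩, h3, h4⟩ := hi
  rcases h with (h | h) | h | h <;> linarith

/-- The divergence theorem on the unit square. -/
theorem integral_unitSq_div {f g : ℝ × ℝ → ℝ} (hf : ContDiff ℝ (⊤ : ℕ∞) f)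
    (hg : ContDiff ℝ (⊤ : ℕ∞) g) :
    ∫ p in unitSq, (pdx f p + pdz g p) =
      (((∫ x in (0 : ℝ)..1, g (x, 1)) - ∫ x in (0 : ℝ)..1, g (x, 0)) +
        ∫ z in (0 : ℝ)..1, f (1, z)) - ∫ z in (0 : ℝ)..1, f (0, z) := by
  rw [unitSq_eq_Icc]
  exact integral_divergence_prod_Icc_of_hasFDerivAt_of_le f g (fderiv ℝ f) (fderiv ℝ g)
    (0, 0) (1, 1) (by simp [Prod.le_def]) hf.continuous.continuousOn hg.continuous.continuousOn
    (fun p _ => (hf.differentiable (by simp) p).hasFDerivAt)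
    (fun p _ => (hg.differentiable (by simp) p).hasFDerivAt)
    ((hf.pdx.continuous.add hg.pdz.continuous).continuousOn.integrableOn_compact isCompact_Icc)

/-- Differentiation under the integral sign over a compact set. -/
theorem hasDerivAt_setIntegral_of_contDiff {E : Type*} [NormedAddCommGroup E] [NormedSpace ℝ E]
    [MeasurableSpace E] [BorelSpace E] [SecondCountableTopology E] {μ : Measure E}
    [IsFiniteMeasureOnCompacts μ] {K : Set E} (hK : IsCompact K) {G : ℝ × E → ℝ}
    (hG : ContDiff ℝ 1 G) (t : ℝ) :
    HasDerivAt (fun s => ∫ p in K, G (s, p) ∂μ)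
      (∫ p in K, deriv (fun s => G (s, p)) t ∂μ) t := by
  have hder (s : ℝ) (p : E) :
      HasDerivAt (fun s => G (s, p)) (fderiv ℝ G (s, p) (1, 0)) s :=
    ((hG.differentiable (by simp) (s, p)).hasFDerivAt).comp_hasDerivAt s
      ((hasDerivAt_id s).prodMk (hasDerivAt_const s p))
  have hcont : Continuous fun q : ℝ × E => fderiv ℝ G q (1, 0) :=
    (hG.continuous_fderiv (by simp)).clm_apply continuous_const
  obtain ⟨C, hC⟩ := ((isCompact_Icc (a := t - 1) (b := t + 1)).prod hK).exists_bound_of_continuousOn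
    hcont.continuousOn
  have hslice {H : ℝ × E → ℝ} (hH : Continuous H) (s : ℝ) :
      IntegrableOn (fun p => H (s, p)) K μ :=
    (hH.comp (Continuous.prodMk_right s)).continuousOn.integrableOn_compact hK
  simp only [fun p => (hder t p).deriv]
  refine (hasDerivAt_integral_of_dominated_loc_of_deriv_le (bound := fun _ => C)
    (F' := fun s p => fderiv ℝ G (s, p) (1, 0))
    (Icc_mem_nhds (by linarith : t - 1 < t) (by linarith : t < t + 1))
    (.of_forall fun s => (hslice hG.continuous s).aestronglyMeasurable)
    (hslice hG.continuous t) (hslice hcont t).aestronglyMeasurable ?_ ?_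
    (.of_forall fun p s _ => hder s p)).2
  · filter_upwards [ae_restrict_mem hK.measurableSet] with p hp s hs
    exact hC (s, p) ⟨hs, hp⟩
  · exact integrableOn_const hK.measure_ne_top

theorem JointlySmooth.slice {f : ℝ → ℝ × ℝ → ℝ} (hf : JointlySmooth f) (t : ℝ) :
    ContDiff ℝ (⊤ : ℕ∞) (f t) :=
  ContDiff.comp (g := fun q : ℝ × (ℝ × ℝ) => f q.1 q.2) hf (contDiff_prodMk_right t)

theorem JointlySmooth.differentiableAt_time {f : ℝ → ℝ × ℝ → ℝ} (hf : JointlySmooth f) (t : ℝ)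
    (p : ℝ × ℝ) : DifferentiableAt ℝ (fun s => f s p) t :=
  (ContDiff.comp (g := fun q : ℝ × (ℝ × ℝ) => f q.1 q.2) hf
    (contDiff_prodMk_left p)).differentiable (by simp) t

/-- The divergence of the energy flux `(2c u uₓ + 2 u u_z φ, 2c u u_z - 2 u uₓ φ)`. -/
theorem energyFlux_div {u φ : ℝ × ℝ → ℝ} (hu : ContDiff ℝ (⊤ : ℕ∞) u)
    (hφ : ContDiff ℝ (⊤ : ℕ∞) φ) (c : ℝ) (p : ℝ × ℝ) :
    pdx (fun q => 2 * c * (u q * pdx u q) + 2 * (u q * (pdz u q * φ q))) p +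
      pdz (fun q => 2 * c * (u q * pdz u q) - 2 * (u q * (pdx u q * φ q))) p =
    2 * c * (pdx u p ^ 2 + pdz u p ^ 2) + 2 * u p * (c * lap u p - Jac u φ p) := by
  have du := hu.differentiable (by simp)
  have dφ := hφ.differentiable (by simp)
  have dux := hu.pdx.differentiable (by simp)
  have duz := hu.pdz.differentiable (by simp)
  rw [pdx_add (by fun_prop) (by fun_prop), pdz_sub (by fun_prop) (by fun_prop),
    pdx_const_mul _ (by fun_prop), pdx_const_mul _ (by fun_prop),
    pdz_const_mul _ (by fun_prop), pdz_const_mul _ (by fun_prop),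
    pdx_mul du dux, pdx_mul du (by fun_prop), pdx_mul duz dφ,
    pdz_mul du duz, pdz_mul du (by fun_prop), pdz_mul dux dφ, pdx_pdz_comm hu]
  simp only [lap, Jac]
  ring

/-- Salinity energy identity: for classical solutions of the transport equation
with prescribed inlet flux `F`,
`(d/dt) ∫_D S² = −(2/Pr) ∫_D |∇S|² − (2/Pr) ∫₀¹ F(z) S(t,0,z) dz`. -/
theorem salinity_energy_identity (Pr : ℝ) (hPr : 0 < Pr) (F : ℝ → ℝ)
    (hF : ContinuousOn F (Set.Icc 0 1))
    (S ψ : ℝ → ℝ × ℝ → ℝ) (hS : JointlySmooth S) (hψ : JointlySmooth ψ)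
    (hψbd : ∀ t ≥ (0:ℝ), ∀ p ∈ frontier unitSq, ψ t p = 0)
    (hinlet : ∀ t ≥ (0:ℝ), ∀ z ∈ Set.Icc (0:ℝ) 1, pdx (S t) (0, z) = F z)
    (houtlet : ∀ t ≥ (0:ℝ), ∀ z ∈ Set.Icc (0:ℝ) 1, pdx (S t) (1, z) = 0)
    (hbot : ∀ t ≥ (0:ℝ), ∀ x ∈ Set.Icc (0:ℝ) 1, pdz (S t) (x, 0) = 0)
    (htop : ∀ t ≥ (0:ℝ), ∀ x ∈ Set.Icc (0:ℝ) 1, pdz (S t) (x, 1) = 0)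
    (hpde : ∀ t ≥ (0:ℝ), ∀ p ∈ unitSq,
      deriv (fun s => S s p) t + Jac (S t) (ψ t) p = (1 / Pr) * lap (S t) p) :
    ∀ t ≥ (0:ℝ),
      HasDerivAt (fun s => ∫ p in unitSq, (S s p) ^ 2)
        (-(2 / Pr) * (∫ p in unitSq, ((pdx (S t) p) ^ 2 + (pdz (S t) p) ^ 2))
          - (2 / Pr) * ∫ z in Set.Icc (0:ℝ) 1, F z * S t (0, z)) t := by
  intro t ht
  have hu := hS.slice t
  have hφ := hψ.slice t
  have hux := hu.pdx
  have huz := hu.pdz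
  have h01 : (0 : ℝ) ∈ Set.Icc (0 : ℝ) 1 := by simp
  have h11 : (1 : ℝ) ∈ Set.Icc (0 : ℝ) 1 := by simp
  have hrate (p : ℝ × ℝ) (hp : p ∈ unitSq) :
      deriv (fun s => S s p ^ 2) t =
        (pdx (fun q => 2 * (1 / Pr) * (S t q * pdx (S t) q)
            + 2 * (S t q * (pdz (S t) q * ψ t q))) p +
          pdz (fun q => 2 * (1 / Pr) * (S t q * pdz (S t) q)
            - 2 * (S t q * (pdx (S t) q * ψ t q))) p) -
        2 / Pr * (pdx (S t) p ^ 2 + pdz (S t) p ^ 2) := by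
    rw [energyFlux_div hu hφ, ← hpde t ht p hp, deriv_fun_pow (hS.differentiableAt_time t p)]
    simp
    ring
  have hleib := hasDerivAt_setIntegral_of_contDiff (μ := volume) isCompact_unitSq
    (G := fun q => S q.1 q.2 ^ 2) ((ContDiff.pow hS 2).of_le (by exact_mod_cast le_top)) t
  convert hleib using 1
  have hf : ContDiff ℝ (⊤ : ℕ∞) fun q => 2 * (1 / Pr) * (S t q * pdx (S t) q)
      + 2 * (S t q * (pdz (S t) q * ψ t q)) := by fun_prop
  have hg : ContDiff ℝ (⊤ : ℕ∞) fun q => 2 * (1 / Pr) * (S t q * pdz (S t) q)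
      - 2 * (S t q * (pdx (S t) q * ψ t q)) := by fun_prop
  have hgrad : Continuous fun p => 2 / Pr * (pdx (S t) p ^ 2 + pdz (S t) p ^ 2) := by
    have := hux.continuous
    have := huz.continuous
    fun_prop
  have hbd (p : ℝ × ℝ) (hp : p ∈ unitSq) (h : (p.1 = 0 ∨ p.1 = 1) ∨ p.2 = 0 ∨ p.2 = 1) :
      ψ t p = 0 := hψbd t ht p (mem_frontier_unitSq hp h)
  rw [setIntegral_congr_fun isCompact_unitSq.measurableSet hrate,
    integral_sub ((hf.pdx.continuous.fun_add hg.pdz.continuous).continuousOn.integrableOn_compact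
      isCompact_unitSq) (hgrad.continuousOn.integrableOn_compact isCompact_unitSq),
    integral_unitSq_div hf hg, integral_const_mul]
  simp only [intervalIntegral.integral_of_le zero_le_one, ← integral_Icc_eq_integral_Ioc]
  have htopflux : ∫ x in Set.Icc (0 : ℝ) 1, (2 * (1 / Pr) * (S t (x, 1) * pdz (S t) (x, 1))
      - 2 * (S t (x, 1) * (pdx (S t) (x, 1) * ψ t (x, 1)))) = 0 :=
    setIntegral_eq_zero_of_forall_eq_zero fun x hx => by
      simp [htop t ht x hx, hbd (x, 1) ⟨hx, h11⟩]
  have hbotflux : ∫ x in Set.Icc (0 : ℝ) 1, (2 * (1 / Pr) * (S t (x, 0) * pdz (S t) (x, 0))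
      - 2 * (S t (x, 0) * (pdx (S t) (x, 0) * ψ t (x, 0)))) = 0 :=
    setIntegral_eq_zero_of_forall_eq_zero fun x hx => by
      simp [hbot t ht x hx, hbd (x, 0) ⟨hx, h01⟩]
  have houtflux : ∫ z in Set.Icc (0 : ℝ) 1, (2 * (1 / Pr) * (S t (1, z) * pdx (S t) (1, z))
      + 2 * (S t (1, z) * (pdz (S t) (1, z) * ψ t (1, z)))) = 0 :=
    setIntegral_eq_zero_of_forall_eq_zero fun z hz => by
      simp [houtlet t ht z hz, hbd (1, z) ⟨h11, hz⟩]
  have hinflux : ∫ z in Set.Icc (0 : ℝ) 1, (2 * (1 / Pr) * (S t (0, z) * pdx (S t) (0, z))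
      + 2 * (S t (0, z) * (pdz (S t) (0, z) * ψ t (0, z)))) =
      2 / Pr * ∫ z in Set.Icc (0 : ℝ) 1, F z * S t (0, z) := by
    rw [← integral_const_mul]
    refine setIntegral_congr_fun measurableSet_Icc fun z hz => ?_
    simp only [hinlet t ht z hz, hbd (0, z) ⟨h01, hz⟩ (by simp)]
    ring
  rw [htopflux, hbotflux, houtflux, hinflux]
  ring
end

section
/- There exists a constant c > 0 such that for every smooth ψ : ℝ² → ℝ with ψ(x,z) = 0 for all (x,z) ∈ ∂D and every smooth S : ℝ² → ℝ, one has (∫_D J(S,ψ)² d(x,z))^{1/2} ≤ c · [(∫_D (Δψ)² d(x,z))^{1/2} + (∫_D |∇(Δψ)|² d(x,z))^{1/2}] · [(∫_D (∂ₓS)² d(x,z))^{1/2} + (∫_D (∂_zS)² d(x,z))^{1/2}]. -/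
open MeasureTheory

open Set

/-- Energy estimate for the two-point problem `b'' - k² b = g`, `b(0) = b(1) = 0`. -/
lemma sq_deriv_le_of_dirichlet {b b₁ b₂ : ℝ → ℝ} {k : ℝ} (hk : 0 < k)
    (hb : ∀ x, HasDerivAt b (b₁ x) x) (hb₁ : ∀ x, HasDerivAt b₁ (b₂ x) x)
    (hb₂ : Continuous b₂) (h0 : b 0 = 0) (h1 : b 1 = 0) {x : ℝ} (hx : x ∈ Icc (0 : ℝ) 1) :
    b₁ x ^ 2 ≤ (∫ t in (0 : ℝ)..1, (b₂ t - k ^ 2 * b t) ^ 2) / k := by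
  have cb : Continuous b := continuous_iff_continuousAt.2 fun x => (hb x).continuousAt
  have cb₁ : Continuous b₁ := continuous_iff_continuousAt.2 fun x => (hb₁ x).continuousAt
  obtain ⟨ξ, hξ, hξ0⟩ : ∃ ξ ∈ Ioo (0 : ℝ) 1, b₁ ξ = 0 :=
    exists_hasDerivAt_eq_zero zero_lt_one cb.continuousOn (h0.trans h1.symm) fun x _ => hb x
  have hparts : ∫ t in (0 : ℝ)..1, (b₂ t * b t + b₁ t * b₁ t) = 0 := by
    rw [intervalIntegral.integral_eq_sub_of_hasDerivAt (fun t _ => (hb₁ t).mul (hb t))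
      (Continuous.intervalIntegrable (by fun_prop) _ _)]
    simp [h0, h1]
  have henergy : ∫ t in (0 : ℝ)..1, (b₂ t ^ 2 + k ^ 2 * b₁ t ^ 2)
      ≤ ∫ t in (0 : ℝ)..1, (b₂ t - k ^ 2 * b t) ^ 2 := by
    calc ∫ t in (0 : ℝ)..1, (b₂ t ^ 2 + k ^ 2 * b₁ t ^ 2)
        ≤ ∫ t in (0 : ℝ)..1,
            ((b₂ t - k ^ 2 * b t) ^ 2 + 2 * k ^ 2 * (b₂ t * b t + b₁ t * b₁ t)) := by
          refine intervalIntegral.integral_mono_on zero_le_one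
            (Continuous.intervalIntegrable (by fun_prop) _ _)
            (Continuous.intervalIntegrable (by fun_prop) _ _) fun t _ => ?_
          nlinarith [sq_nonneg (k * b₁ t), sq_nonneg (k ^ 2 * b t)]
      _ = ∫ t in (0 : ℝ)..1, (b₂ t - k ^ 2 * b t) ^ 2 := by
          rw [intervalIntegral.integral_add (Continuous.intervalIntegrable (by fun_prop) _ _)
            (Continuous.intervalIntegrable (by fun_prop) _ _),
            intervalIntegral.integral_const_mul, hparts]
          ring
  have hftc : ∫ t in ξ..x, 2 * (b₁ t * b₂ t) = b₁ x ^ 2 := by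
    rw [intervalIntegral.integral_eq_sub_of_hasDerivAt (f := fun t => b₁ t ^ 2)
      (fun t _ => by simpa [mul_assoc] using (hb₁ t).fun_pow 2)
      (Continuous.intervalIntegrable (by fun_prop) _ _)]
    simp [hξ0]
  rw [le_div_iff₀ hk]
  calc b₁ x ^ 2 * k ≤ ‖∫ t in ξ..x, 2 * (b₁ t * b₂ t)‖ * k := by
        rw [hftc, Real.norm_of_nonneg (sq_nonneg _)]
    _ ≤ (∫ t in (0 : ℝ)..1, ‖2 * (b₁ t * b₂ t)‖) * k := by
        gcongr
        refine intervalIntegral.norm_integral_le_integral_norm_uIoc.trans ?_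
        rw [intervalIntegral.integral_of_le zero_le_one]
        refine setIntegral_mono_set (Continuous.integrableOn_Ioc (by fun_prop))
          (Filter.Eventually.of_forall fun _ => norm_nonneg _) (LE.le.eventuallyLE ?_)
        exact Ioc_subset_Ioc (le_min hξ.1.le hx.1) (max_le hξ.2.le hx.2)
    _ = ∫ t in (0 : ℝ)..1, ‖2 * (b₁ t * b₂ t)‖ * k := by rw [intervalIntegral.integral_mul_const]
    _ ≤ ∫ t in (0 : ℝ)..1, (b₂ t ^ 2 + k ^ 2 * b₁ t ^ 2) := by
        refine intervalIntegral.integral_mono_on zero_le_one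
          (Continuous.intervalIntegrable (by fun_prop) _ _)
            (Continuous.intervalIntegrable (by fun_prop) _ _) fun t _ => ?_
        rw [Real.norm_eq_abs, ← abs_of_pos hk, ← abs_mul, abs_of_pos hk, abs_le]
        constructor <;> nlinarith [sq_nonneg (b₂ t - k * b₁ t), sq_nonneg (b₂ t + k * b₁ t)]
    _ ≤ _ := henergy

lemma sq_integral_abs_le {h : ℝ → ℝ} (hh : Continuous h) :
    (∫ t in (0 : ℝ)..1, |h t|) ^ 2 ≤ ∫ t in (0 : ℝ)..1, h t ^ 2 := by
  set m := ∫ t in (0 : ℝ)..1, |h t| with hm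
  have hnn : 0 ≤ ∫ t in (0 : ℝ)..1, (|h t| - m) ^ 2 :=
    intervalIntegral.integral_nonneg zero_le_one fun _ _ => sq_nonneg _
  have heq : ∫ t in (0 : ℝ)..1, (|h t| - m) ^ 2 =
      (∫ t in (0 : ℝ)..1, h t ^ 2) - 2 * m * m + m ^ 2 := by
    have : ∀ t, (|h t| - m) ^ 2 = h t ^ 2 - 2 * m * |h t| + m ^ 2 := fun t => by
      rw [sub_sq, sq_abs]; ring
    simp_rw [this]
    rw [intervalIntegral.integral_add (Continuous.intervalIntegrable (by fun_prop) _ _)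
      (Continuous.intervalIntegrable (by fun_prop) _ _),
      intervalIntegral.integral_sub (Continuous.intervalIntegrable (by fun_prop) _ _)
      (Continuous.intervalIntegrable (by fun_prop) _ _), intervalIntegral.integral_const_mul, ← hm]
    simp
  nlinarith

lemma abs_le_integral_add_integral_deriv {q q' : ℝ → ℝ} (hq : ∀ x, HasDerivAt q (q' x) x)
    (hq' : Continuous q') {a : ℝ} (ha : a ∈ Icc (0 : ℝ) 1) :
    |q a| ≤ (∫ t in (0 : ℝ)..1, |q t|) + ∫ t in (0 : ℝ)..1, |q' t| := by
  have cq : Continuous q := continuous_iff_continuousAt.2 fun x => (hq x).continuousAt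
  have hpt : ∀ z ∈ Icc (0 : ℝ) 1, |q a| ≤ |q z| + ∫ t in (0 : ℝ)..1, |q' t| := fun z hz => by
    have hd : |q a - q z| ≤ ∫ t in (0 : ℝ)..1, |q' t| := by
      rw [← intervalIntegral.integral_eq_sub_of_hasDerivAt (fun t _ => hq t)
        (hq'.intervalIntegrable _ _), ← Real.norm_eq_abs]
      refine intervalIntegral.norm_integral_le_integral_norm_uIoc.trans ?_
      rw [intervalIntegral.integral_of_le zero_le_one]
      refine setIntegral_mono_set (Continuous.integrableOn_Ioc (by fun_prop))
        (Filter.Eventually.of_forall fun _ => norm_nonneg _) (LE.le.eventuallyLE ?_)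
      exact Ioc_subset_Ioc (le_min hz.1 ha.1) (max_le hz.2 ha.2)
    linarith [abs_sub_abs_le_abs_sub (q a) (q z)]
  have hint := intervalIntegral.integral_mono_on zero_le_one
    (intervalIntegrable_const (μ := volume)) (Continuous.intervalIntegrable (by fun_prop) _ _) hpt
  rw [intervalIntegral.integral_add (Continuous.intervalIntegrable (by fun_prop) _ _)
    intervalIntegrable_const] at hint
  simpa using hint

/-- Sine coefficients of a function with square-integrable derivative decay like `1 / k`. -/
lemma sq_mul_integral_sin_le {q q' : ℝ → ℝ} (hq : ∀ x, HasDerivAt q (q' x) x)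
    (hq' : Continuous q') (k : ℝ) :
    (k * ∫ z in (0 : ℝ)..1, q z * Real.sin (k * z)) ^ 2 ≤
      18 * ∫ z in (0 : ℝ)..1, (q z ^ 2 + q' z ^ 2) := by
  have cq : Continuous q := continuous_iff_continuousAt.2 fun x => (hq x).continuousAt
  have hder : ∀ z, HasDerivAt (fun z => -(q z * Real.cos (k * z)))
      (k * (q z * Real.sin (k * z)) - q' z * Real.cos (k * z)) z := fun z => by
    have hc := ((hasDerivAt_id' z).const_mul k).cos
    refine ((hq z).fun_mul hc).fun_neg.congr_deriv ?_
    ring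
  have hparts : k * (∫ z in (0 : ℝ)..1, q z * Real.sin (k * z)) =
      q 0 - q 1 * Real.cos k + ∫ z in (0 : ℝ)..1, q' z * Real.cos (k * z) := by
    have := intervalIntegral.integral_eq_sub_of_hasDerivAt (a := 0) (b := 1) (fun z _ => hder z)
      (Continuous.intervalIntegrable (by fun_prop) _ _)
    rw [intervalIntegral.integral_sub (Continuous.intervalIntegrable (by fun_prop) _ _)
      (Continuous.intervalIntegrable (by fun_prop) _ _), intervalIntegral.integral_const_mul] at this
    simp only [mul_one, mul_zero, Real.cos_zero] at this
    linarith
  have hcos : |∫ z in (0 : ℝ)..1, q' z * Real.cos (k * z)| ≤ ∫ z in (0 : ℝ)..1, |q' z| := by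
    refine (intervalIntegral.abs_integral_le_integral_abs zero_le_one).trans ?_
    refine intervalIntegral.integral_mono_on zero_le_one
      (Continuous.intervalIntegrable (by fun_prop) _ _)
      (Continuous.intervalIntegrable (by fun_prop) _ _) fun z _ => ?_
    rw [abs_mul]
    exact mul_le_of_le_one_right (abs_nonneg _) (Real.abs_cos_le_one _)
  have h0 := abs_le_integral_add_integral_deriv hq hq' (a := 0) (by simp)
  have h1 := abs_le_integral_add_integral_deriv hq hq' (a := 1) (by simp)
  have h1c : |q 1 * Real.cos k| ≤ |q 1| := by
    rw [abs_mul]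
    exact mul_le_of_le_one_right (abs_nonneg _) (Real.abs_cos_le_one _)
  have hA := sq_integral_abs_le cq
  have hB := sq_integral_abs_le hq'
  have hA0 : 0 ≤ ∫ z in (0 : ℝ)..1, |q z| :=
    intervalIntegral.integral_nonneg zero_le_one fun _ _ => abs_nonneg _
  have hB0 : 0 ≤ ∫ z in (0 : ℝ)..1, |q' z| :=
    intervalIntegral.integral_nonneg zero_le_one fun _ _ => abs_nonneg _
  rw [hparts, intervalIntegral.integral_add (Continuous.intervalIntegrable (by fun_prop) _ _)
      (Continuous.intervalIntegrable (by fun_prop) _ _), ← sq_abs]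
  set A := ∫ z in (0 : ℝ)..1, |q z|
  set B := ∫ z in (0 : ℝ)..1, |q' z|
  have habs : |q 0 - q 1 * Real.cos k + ∫ z in (0 : ℝ)..1, q' z * Real.cos (k * z)|
      ≤ 2 * A + 3 * B := by
    have := abs_add_le (q 0 - q 1 * Real.cos k) (∫ z in (0 : ℝ)..1, q' z * Real.cos (k * z))
    have := abs_sub (q 0) (q 1 * Real.cos k)
    linarith
  have := pow_le_pow_left₀ (abs_nonneg _) habs 2
  nlinarith [sq_nonneg (2 * A - 3 * B), sq_nonneg A]

lemma integral_deriv2_mul_sin {f f₁ f₂ : ℝ → ℝ} (hf : ∀ x, HasDerivAt f (f₁ x) x)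
    (hf₁ : ∀ x, HasDerivAt f₁ (f₂ x) x) (hf₂ : Continuous f₂) (h0 : f 0 = 0) (h1 : f 1 = 0)
    (n : ℕ) :
    ∫ z in (0 : ℝ)..1, f₂ z * Real.sin (n * Real.pi * z) =
      -((n * Real.pi) ^ 2 * ∫ z in (0 : ℝ)..1, f z * Real.sin (n * Real.pi * z)) := by
  have cf : Continuous f := continuous_iff_continuousAt.2 fun x => (hf x).continuousAt
  set k : ℝ := n * Real.pi with hk
  have hder : ∀ z, HasDerivAt (fun z => f₁ z * Real.sin (k * z) - k * (f z * Real.cos (k * z)))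
      (f₂ z * Real.sin (k * z) + k ^ 2 * (f z * Real.sin (k * z))) z := fun z => by
    have hs := ((hasDerivAt_id' z).const_mul k).sin
    have hc := ((hasDerivAt_id' z).const_mul k).cos
    refine (((hf₁ z).fun_mul hs).fun_sub (((hf z).fun_mul hc).const_mul k)).congr_deriv ?_
    ring
  have := intervalIntegral.integral_eq_sub_of_hasDerivAt (a := 0) (b := 1) (fun z _ => hder z)
    (Continuous.intervalIntegrable (by fun_prop) _ _)
  rw [intervalIntegral.integral_add (Continuous.intervalIntegrable (by fun_prop) _ _)
      (Continuous.intervalIntegrable (by fun_prop) _ _), intervalIntegral.integral_const_mul] at this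
  have hsin : Real.sin k = 0 := Real.sin_nat_mul_pi n
  simp [h0, h1, hsin] at this
  linarith

lemma hasDerivAt_integral_mul {f f' : ℝ × ℝ → ℝ} {w : ℝ → ℝ}
    (hf : ∀ x z, HasDerivAt (fun x => f (x, z)) (f' (x, z)) x)
    (cf : Continuous f) (cf' : Continuous f') (cw : Continuous w) (x : ℝ) :
    HasDerivAt (fun x => ∫ z in (0 : ℝ)..1, f (x, z) * w z)
      (∫ z in (0 : ℝ)..1, f' (x, z) * w z) x := by
  have hK : IsCompact (Icc (x - 1) (x + 1) ×ˢ Icc (0 : ℝ) 1) := isCompact_Icc.prod isCompact_Icc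
  obtain ⟨C, hC⟩ := hK.exists_bound_of_continuousOn
    (f := fun p : ℝ × ℝ => f' p * w p.2) (by fun_prop)
  refine (intervalIntegral.hasDerivAt_integral_of_dominated_loc_of_deriv_le (bound := fun _ => C)
    (F := fun x z => f (x, z) * w z) (F' := fun x z => f' (x, z) * w z)
    (Icc_mem_nhds (sub_one_lt x) (lt_add_one x))
    (Filter.Eventually.of_forall fun y => Continuous.aestronglyMeasurable (by fun_prop))
    (Continuous.intervalIntegrable (by fun_prop) _ _)
    (Continuous.aestronglyMeasurable (by fun_prop)) ?_ intervalIntegrable_const ?_).2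
  · refine Filter.Eventually.of_forall fun t ht y hy => hC (y, t) ⟨hy, ?_⟩
    rw [uIoc_of_le zero_le_one] at ht
    exact Ioc_subset_Icc_self ht
  · exact Filter.Eventually.of_forall fun t _ y _ => (hf y t).mul_const _

/-- A continuous function vanishing at `0` and `1` whose sine coefficients are `O(n^(-3/2))` is
bounded by the sum of its sine series. -/
lemma abs_le_of_sine_coeff_le {f : ℝ → ℝ} (hf : Continuous f) (h0 : f 0 = 0) (h1 : f 1 = 0)
    {M : ℝ}
    (hM : ∀ n : ℕ, 0 < n →
      |∫ z in (0 : ℝ)..1, f z * Real.sin (n * Real.pi * z)| ≤ M * (n : ℝ) ^ (-(3 / 2) : ℝ))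
    {z : ℝ} (hz : z ∈ Icc (0 : ℝ) 1) :
    |f z| ≤ M * ∑' n : ℤ, |(n : ℝ)| ^ (-(3 / 2) : ℝ) := by
  have : Fact ((0 : ℝ) < 2) := ⟨two_pos⟩
  set F : ℝ → ℂ := fun t => if t ≤ 1 then (f t : ℂ) else -(f (2 - t) : ℂ) with hF
  have cF : Continuous F := by
    refine Continuous.if_le (by fun_prop) (by fun_prop) continuous_id continuous_const ?_
    rintro x rfl
    norm_num [h1]
  have cG : Continuous (AddCircle.liftIco (2 : ℝ) 0 F) := by
    refine AddCircle.liftIco_zero_continuous ?_ cF.continuousOn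
    simp [hF, h0]
  let G : C(AddCircle (2 : ℝ), ℂ) := ⟨_, cG⟩
  have hcoeff : ∀ n : ℤ, fourierCoeff G n =
      -Complex.I * ((∫ z in (0 : ℝ)..1, f z * Real.sin (n * Real.pi * z) : ℝ) : ℂ) := fun n => by
    have hexp : ∀ t : ℝ, fourier (-n) (t : AddCircle (2 : ℝ)) =
        Complex.exp (-((n * Real.pi * t : ℝ) : ℂ) * Complex.I) := fun t => by
      rw [fourier_coe_apply]; congr 1; push_cast; ring
    have hG : fourierCoeff G n =
        (1 / 2 : ℝ) • ∫ t in (0 : ℝ)..2, fourier (-n) (t : AddCircle (2 : ℝ)) • F t := by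
      change fourierCoeff (AddCircle.liftIco (2 : ℝ) 0 F) n = _
      rw [fourierCoeff_eq_intervalIntegral _ _ 0, zero_add]
      congr 1
      refine intervalIntegral.integral_congr_Ioo_of_le zero_le_two fun t ht => ?_
      rw [AddCircle.liftIco_coe_apply (Ioo_subset_Ico_self (by simpa using ht))]
    have hleft : ∫ t in (0 : ℝ)..1, fourier (-n) (t : AddCircle (2 : ℝ)) • F t =
        ∫ t in (0 : ℝ)..1, Complex.exp (-((n * Real.pi * t : ℝ) : ℂ) * Complex.I) * f t := by
      refine intervalIntegral.integral_congr fun t ht => ?_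
      rw [uIcc_of_le zero_le_one] at ht
      simp only [hexp, hF, if_pos ht.2, smul_eq_mul]
    have hright : ∫ t in (1 : ℝ)..2, fourier (-n) (t : AddCircle (2 : ℝ)) • F t =
        ∫ t in (0 : ℝ)..1, -(Complex.exp (((n * Real.pi * t : ℝ) : ℂ) * Complex.I) * f t) := by
      have hsub := intervalIntegral.integral_comp_sub_left (a := 0) (b := 1)
        (fun t : ℝ => fourier (-n) (t : AddCircle (2 : ℝ)) • F t) 2
      rw [sub_zero, show (2 : ℝ) - 1 = 1 by norm_num] at hsub
      rw [← hsub]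
      refine intervalIntegral.integral_congr fun t ht => ?_
      rw [uIcc_of_le zero_le_one] at ht
      have hFt : F (2 - t) = -(f t : ℂ) := by
        rcases eq_or_lt_of_le ht.2 with rfl | hlt
        · norm_num [hF, h1]
        · have : ¬ (2 - t ≤ 1) := by linarith
          simp [hF, this]
      have hper : fourier (-n) ((2 - t : ℝ) : AddCircle (2 : ℝ)) =
          Complex.exp (((n * Real.pi * t : ℝ) : ℂ) * Complex.I) := by
        rw [hexp, Complex.exp_eq_exp_iff_exists_int]
        exact ⟨-n, by push_cast; ring⟩
      simp only [AddCircle.coe_sub] at hper ⊢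
      simp only [hFt, hper, smul_eq_mul]
      ring
    have cE : Continuous fun t : ℝ => fourier (-n) (t : AddCircle (2 : ℝ)) • F t := by
      simp only [hexp]
      fun_prop
    rw [hG, ← intervalIntegral.integral_add_adjacent_intervals (cE.intervalIntegrable 0 1)
      (cE.intervalIntegrable 1 2), hleft, hright,
      ← intervalIntegral.integral_add (Continuous.intervalIntegrable (by fun_prop) _ _)
        (Continuous.intervalIntegrable (by fun_prop) _ _), ← intervalIntegral.integral_ofReal,
      ← intervalIntegral.integral_const_mul, ← intervalIntegral.integral_smul]
    refine intervalIntegral.integral_congr fun t _ => ?_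
    simp only [Complex.real_smul, Complex.ofReal_mul, Complex.ofReal_sin, Complex.sin]
    push_cast
    linear_combination (1 / 2 * (f t : ℂ) * (Complex.exp (-(n * Real.pi * t) * Complex.I) -
      Complex.exp (n * Real.pi * t * Complex.I))) * Complex.I_sq
  have hbound : ∀ n : ℤ, ‖fourierCoeff G n‖ ≤ M * |(n : ℝ)| ^ (-(3 / 2) : ℝ) := fun n => by
    rw [hcoeff, norm_mul, norm_neg, Complex.norm_I, one_mul, Complex.norm_real, Real.norm_eq_abs]
    rcases eq_or_ne n 0 with rfl | hn
    · simp [Real.zero_rpow]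
    have hnat := hM n.natAbs (Int.natAbs_pos.2 hn)
    rw [Nat.cast_natAbs, Int.cast_abs] at hnat
    refine le_trans (le_of_eq ?_) hnat
    rcases abs_choice (n : ℝ) with h | h
    · rw [h]
    · simp [h]
  have hsum : Summable fun n : ℤ => M * |(n : ℝ)| ^ (-(3 / 2) : ℝ) :=
    (Real.summable_abs_int_rpow (by norm_num)).mul_left _
  have hpt := has_pointwise_sum_fourier_series_of_summable
    (Summable.of_norm_bounded hsum hbound) (z : AddCircle (2 : ℝ))
  have hGz : G (z : AddCircle (2 : ℝ)) = f z := by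
    change AddCircle.liftIco (2 : ℝ) 0 F z = _
    rw [AddCircle.liftIco_coe_apply ⟨hz.1, by linarith [hz.2]⟩]
    simp [hF, hz.2]
  rw [← Real.norm_eq_abs, ← Complex.norm_real, ← hGz, ← hpt.tsum_eq, ← tsum_mul_left]
  refine tsum_of_norm_bounded hsum.hasSum fun n => ?_
  rw [norm_smul]
  exact (mul_le_of_le_one_right (norm_nonneg _)
    ((fourier n).norm_coe_le_norm _ |>.trans (fourier_norm n).le)).trans (hbound n)

lemma contDiff_pdx {f : ℝ × ℝ → ℝ} (hf : ContDiff ℝ (⊤ : ℕ∞) f) :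
    ContDiff ℝ (⊤ : ℕ∞) (pdx f) :=
  (hf.fderiv_right (m := (⊤ : ℕ∞)) (by simp)).clm_apply contDiff_const

lemma contDiff_pdz {f : ℝ × ℝ → ℝ} (hf : ContDiff ℝ (⊤ : ℕ∞) f) :
    ContDiff ℝ (⊤ : ℕ∞) (pdz f) :=
  (hf.fderiv_right (m := (⊤ : ℕ∞)) (by simp)).clm_apply contDiff_const

lemma contDiff_lap {f : ℝ × ℝ → ℝ} (hf : ContDiff ℝ (⊤ : ℕ∞) f) :
    ContDiff ℝ (⊤ : ℕ∞) (lap f) :=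
  (contDiff_pdx (contDiff_pdx hf)).add (contDiff_pdz (contDiff_pdz hf))

lemma hasDerivAt_fst_pdx {f : ℝ × ℝ → ℝ} (hf : ContDiff ℝ (⊤ : ℕ∞) f) (x z : ℝ) :
    HasDerivAt (fun x => f (x, z)) (pdx f (x, z)) x :=
  ((hf.differentiable (by simp)) (x, z)).hasFDerivAt.comp_hasDerivAt x
    ((hasDerivAt_id' x).prodMk (hasDerivAt_const x z))

lemma hasDerivAt_snd_pdz {f : ℝ × ℝ → ℝ} (hf : ContDiff ℝ (⊤ : ℕ∞) f) (x z : ℝ) :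
    HasDerivAt (fun z => f (x, z)) (pdz f (x, z)) z :=
  ((hf.differentiable (by simp)) (x, z)).hasFDerivAt.comp_hasDerivAt z
    ((hasDerivAt_const z x).prodMk (hasDerivAt_id' z))

lemma frontier_unitSq :
    frontier unitSq = Icc (0 : ℝ) 1 ×ˢ {0, 1} ∪ {0, 1} ×ˢ Icc (0 : ℝ) 1 := by
  rw [unitSq, frontier_prod_eq, isClosed_Icc.closure_eq, frontier_Icc zero_le_one]

lemma integrableOn_unitSq {f : ℝ × ℝ → ℝ} (hf : Continuous f) : IntegrableOn f unitSq :=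
  hf.continuousOn.integrableOn_compact (isCompact_Icc.prod isCompact_Icc)

lemma measurableSet_unitSq : MeasurableSet unitSq := measurableSet_Icc.prod measurableSet_Icc

lemma setIntegral_unitSq {f : ℝ × ℝ → ℝ} (hf : Continuous f) :
    ∫ p in unitSq, f p = ∫ x in (0 : ℝ)..1, ∫ z in (0 : ℝ)..1, f (x, z) := by
  have h := setIntegral_prod (μ := volume) (ν := volume) f (integrableOn_unitSq hf)
  simp only [intervalIntegral.integral_of_le zero_le_one, ← integral_Icc_eq_integral_Ioc]
  exact h

lemma pdx_eq_zero_of_eq_zero {f : ℝ × ℝ → ℝ} (hf : ContDiff ℝ (⊤ : ℕ∞) f) {z : ℝ}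
    (hz : ∀ x ∈ Icc (0 : ℝ) 1, f (x, z) = 0) {x : ℝ} (hx : x ∈ Icc (0 : ℝ) 1) :
    pdx f (x, z) = 0 :=
  (uniqueDiffOn_Icc zero_lt_one x hx).eq_deriv _ (hasDerivAt_fst_pdx hf x z).hasDerivWithinAt
    ((hasDerivWithinAt_const x _ (0 : ℝ)).congr hz (hz x hx))

/-- The `n`-th sine coefficient in `z` of `∂ₓψ` is `O(n^(-3/2))`, uniformly in `x`. -/
lemma abs_sine_coeff_pdx_le {ψ : ℝ × ℝ → ℝ} (hψ : ContDiff ℝ (⊤ : ℕ∞) ψ)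
    (h0 : ∀ p ∈ frontier unitSq, ψ p = 0) {x : ℝ} (hx : x ∈ Icc (0 : ℝ) 1) {n : ℕ} (hn : 0 < n) :
    |∫ z in (0 : ℝ)..1, pdx ψ (x, z) * Real.sin (n * Real.pi * z)| ≤
      Real.sqrt (18 * ∫ p in unitSq, ((lap ψ p) ^ 2 + (pdz (lap ψ) p) ^ 2)) *
        (n : ℝ) ^ (-(3 / 2) : ℝ) := by
  have hx₁ := contDiff_pdx hψ
  have hx₂ := contDiff_pdx hx₁
  have hx₃ := contDiff_pdx hx₂
  have hz₁ := contDiff_pdz hψ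
  have hz₂ := contDiff_pdz hz₁
  have hq := contDiff_lap hψ
  have hqz := contDiff_pdz hq
  have cψ := hψ.continuous
  have cx₁ := hx₁.continuous
  have cx₂ := hx₂.continuous
  have cz₂ := hz₂.continuous
  have cq := hq.continuous
  have cqz := hqz.continuous
  rw [frontier_unitSq] at h0
  set k : ℝ := n * Real.pi with hk
  have hn' : (0 : ℝ) < n := Nat.cast_pos.2 hn
  have hkpos : 0 < k := mul_pos hn' Real.pi_pos
  have hnk : (n : ℝ) ≤ k := le_mul_of_one_le_right hn'.le (by linarith [Real.pi_gt_three])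
  have cs : Continuous fun z : ℝ => Real.sin (k * z) := by fun_prop
  have hb₂ : Continuous fun x => ∫ z in (0 : ℝ)..1, pdx (pdx ψ) (x, z) * Real.sin (k * z) :=
    continuous_iff_continuousAt.2 fun x =>
      (hasDerivAt_integral_mul (hasDerivAt_fst_pdx hx₂) cx₂ hx₃.continuous cs x).continuousAt
  have hode := sq_deriv_le_of_dirichlet hkpos
    (hasDerivAt_integral_mul (hasDerivAt_fst_pdx hψ) cψ cx₁ cs)
    (hasDerivAt_integral_mul (hasDerivAt_fst_pdx hx₁) cx₁ cx₂ cs) hb₂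
    (by
      rw [intervalIntegral.integral_congr (g := fun _ => 0), intervalIntegral.integral_zero]
      intro z hz
      rw [uIcc_of_le zero_le_one] at hz
      simp [h0 (0, z) (Or.inr ⟨by simp, hz⟩)])
    (by
      rw [intervalIntegral.integral_congr (g := fun _ => 0), intervalIntegral.integral_zero]
      intro z hz
      rw [uIcc_of_le zero_le_one] at hz
      simp [h0 (1, z) (Or.inr ⟨by simp, hz⟩)])
    hx
  set Q := ∫ p in unitSq, ((lap ψ p) ^ 2 + (pdz (lap ψ) p) ^ 2) with hQ
  have hQ' : Q = ∫ x in (0 : ℝ)..1, ∫ z in (0 : ℝ)..1,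
      ((lap ψ (x, z)) ^ 2 + (pdz (lap ψ) (x, z)) ^ 2) := setIntegral_unitSq (by fun_prop)
  have hQ0 : 0 ≤ Q := integral_nonneg fun _ => by positivity
  have hsource : (∫ x in (0 : ℝ)..1,
      ((∫ z in (0 : ℝ)..1, pdx (pdx ψ) (x, z) * Real.sin (k * z)) -
        k ^ 2 * ∫ z in (0 : ℝ)..1, ψ (x, z) * Real.sin (k * z)) ^ 2) ≤ 18 * Q / k ^ 2 := by
    rw [hQ', ← intervalIntegral.integral_const_mul, ← intervalIntegral.integral_div]
    refine intervalIntegral.integral_mono_on zero_le_one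
      (Continuous.intervalIntegrable (by fun_prop) _ _)
      (Continuous.intervalIntegrable (by fun_prop) _ _) fun x hx => ?_
    have hparts := integral_deriv2_mul_sin (hasDerivAt_snd_pdz hψ x) (hasDerivAt_snd_pdz hz₁ x)
      (by fun_prop) (h0 _ (Or.inl ⟨hx, by simp⟩)) (h0 _ (Or.inl ⟨hx, by simp⟩)) n
    have hlap : (∫ z in (0 : ℝ)..1, pdx (pdx ψ) (x, z) * Real.sin (k * z)) -
        k ^ 2 * (∫ z in (0 : ℝ)..1, ψ (x, z) * Real.sin (k * z)) =
        ∫ z in (0 : ℝ)..1, lap ψ (x, z) * Real.sin (k * z) := by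
      simp only [lap, add_mul]
      rw [intervalIntegral.integral_add (Continuous.intervalIntegrable (by fun_prop) _ _)
        (Continuous.intervalIntegrable (by fun_prop) _ _), hparts]
      ring
    rw [hlap, le_div_iff₀ (by positivity), ← mul_pow, mul_comm _ k]
    exact sq_mul_integral_sin_le (hasDerivAt_snd_pdz hq x) (by fun_prop) k
  refine abs_le_of_sq_le_sq ?_ (by positivity)
  have hpow : ((n : ℝ) ^ (-(3 / 2) : ℝ)) ^ 2 = ((n : ℝ) ^ 3)⁻¹ := by
    rw [← Real.rpow_natCast, ← Real.rpow_mul hn'.le, ← Real.rpow_natCast, ← Real.rpow_neg hn'.le]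
    norm_num
  rw [mul_pow, Real.sq_sqrt (by positivity), hpow]
  calc _ ≤ _ := hode
    _ ≤ 18 * Q / k ^ 2 / k := by gcongr
    _ = 18 * Q * (k ^ 3)⁻¹ := by field_simp
    _ ≤ 18 * Q * ((n : ℝ) ^ 3)⁻¹ := by gcongr

/-- Pointwise bound for `∂ₓψ` on the unit square in terms of the `H¹` norm of `Δψ`. -/
lemma abs_pdx_le {ψ : ℝ × ℝ → ℝ} (hψ : ContDiff ℝ (⊤ : ℕ∞) ψ)
    (h0 : ∀ p ∈ frontier unitSq, ψ p = 0) {p : ℝ × ℝ} (hp : p ∈ unitSq) :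
    |pdx ψ p| ≤ Real.sqrt (18 * ∫ p in unitSq, ((lap ψ p) ^ 2 + (pdz (lap ψ) p) ^ 2)) *
      ∑' n : ℤ, |(n : ℝ)| ^ (-(3 / 2) : ℝ) := by
  have cx := (contDiff_pdx hψ).continuous
  have h0' := h0
  rw [frontier_unitSq] at h0'
  exact abs_le_of_sine_coeff_le (f := fun z => pdx ψ (p.1, z)) (by fun_prop)
    (pdx_eq_zero_of_eq_zero hψ (fun x hx => h0' _ (Or.inl ⟨hx, by simp⟩)) hp.1)
    (pdx_eq_zero_of_eq_zero hψ (fun x hx => h0' _ (Or.inl ⟨hx, by simp⟩)) hp.1)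
    (fun n hn => abs_sine_coeff_pdx_le hψ h0 hp.1 hn) hp.2

lemma contDiff_comp_swap {f : ℝ × ℝ → ℝ} (hf : ContDiff ℝ (⊤ : ℕ∞) f) :
    ContDiff ℝ (⊤ : ℕ∞) (f ∘ Prod.swap) :=
  hf.comp (contDiff_snd.prodMk contDiff_fst)

lemma pdx_comp_swap {f : ℝ × ℝ → ℝ} (hf : ContDiff ℝ (⊤ : ℕ∞) f) :
    pdx (f ∘ Prod.swap) = pdz f ∘ Prod.swap := by
  funext ⟨x, z⟩
  exact (hasDerivAt_fst_pdx (contDiff_comp_swap hf) x z).unique (hasDerivAt_snd_pdz hf z x)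

lemma pdz_comp_swap {f : ℝ × ℝ → ℝ} (hf : ContDiff ℝ (⊤ : ℕ∞) f) :
    pdz (f ∘ Prod.swap) = pdx f ∘ Prod.swap := by
  funext ⟨x, z⟩
  exact (hasDerivAt_snd_pdz (contDiff_comp_swap hf) x z).unique (hasDerivAt_fst_pdx hf z x)

lemma lap_comp_swap {f : ℝ × ℝ → ℝ} (hf : ContDiff ℝ (⊤ : ℕ∞) f) :
    lap (f ∘ Prod.swap) = lap f ∘ Prod.swap := by
  funext p
  simp only [lap, pdx_comp_swap hf, pdz_comp_swap hf, pdx_comp_swap (contDiff_pdz hf),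
    pdz_comp_swap (contDiff_pdx hf), Function.comp_apply]
  ring

/-- Pointwise bound for `∂_zψ` on the unit square in terms of the `H¹` norm of `Δψ`. -/
lemma abs_pdz_le {ψ : ℝ × ℝ → ℝ} (hψ : ContDiff ℝ (⊤ : ℕ∞) ψ)
    (h0 : ∀ p ∈ frontier unitSq, ψ p = 0) {p : ℝ × ℝ} (hp : p ∈ unitSq) :
    |pdz ψ p| ≤ Real.sqrt (18 * ∫ p in unitSq, ((lap ψ p) ^ 2 + (pdx (lap ψ) p) ^ 2)) *
      ∑' n : ℤ, |(n : ℝ)| ^ (-(3 / 2) : ℝ) := by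
  have h := abs_pdx_le (contDiff_comp_swap hψ) (p := p.swap)
    (fun q hq => h0 _ (by
      rw [frontier_unitSq] at hq ⊢
      exact hq.symm.imp And.symm And.symm)) hp.symm
  rw [lap_comp_swap hψ, pdx_comp_swap hψ, pdz_comp_swap (contDiff_lap hψ)] at h
  have hswap := setIntegral_prod_swap (μ := volume) (ν := volume) (Icc (0 : ℝ) 1) (Icc (0 : ℝ) 1)
    fun p => (lap ψ p) ^ 2 + (pdx (lap ψ) p) ^ 2
  simp only [Function.comp_apply, Prod.swap_swap] at h
  rwa [show ∫ p in unitSq, ((lap ψ p.swap) ^ 2 + (pdx (lap ψ) p.swap) ^ 2) =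
    ∫ p in unitSq, ((lap ψ p) ^ 2 + (pdx (lap ψ) p) ^ 2) from hswap] at h

lemma sqrt_add_le_sqrt_add_sqrt {a b : ℝ} (ha : 0 ≤ a) (hb : 0 ≤ b) :
    Real.sqrt (a + b) ≤ Real.sqrt a + Real.sqrt b := by
  rw [Real.sqrt_le_left (by positivity), add_sq, Real.sq_sqrt ha, Real.sq_sqrt hb]
  linarith [mul_nonneg (Real.sqrt_nonneg a) (Real.sqrt_nonneg b)]

/-- Continuity estimate for the nonlinear operator `F₁`: with vorticity
`q = −Δψ`, the `L²` norm of `J(S,ψ)` is bounded by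
`c ‖q‖_{W₂¹} ‖S‖_{W₂¹}`-type products. -/
theorem jacobian_bilinear_bound :
    ∃ c : ℝ, 0 < c ∧ ∀ ψ : ℝ × ℝ → ℝ, ContDiff ℝ (⊤ : ℕ∞) ψ →
      (∀ p ∈ frontier unitSq, ψ p = 0) →
      ∀ S : ℝ × ℝ → ℝ, ContDiff ℝ (⊤ : ℕ∞) S →
      Real.sqrt (∫ p in unitSq, (Jac S ψ p) ^ 2) ≤
        c * (Real.sqrt (∫ p in unitSq, (lap ψ p) ^ 2) +
            Real.sqrt (∫ p in unitSq, ((pdx (lap ψ) p) ^ 2 + (pdz (lap ψ) p) ^ 2))) *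
          (Real.sqrt (∫ p in unitSq, (pdx S p) ^ 2) +
            Real.sqrt (∫ p in unitSq, (pdz S p) ^ 2)) := by
  set C : ℝ := ∑' n : ℤ, |(n : ℝ)| ^ (-(3 / 2) : ℝ) with hC
  have hC0 : 0 ≤ C := tsum_nonneg fun _ => by positivity
  refine ⟨6 * C + 1, by positivity, fun ψ hψ h0 S hS => ?_⟩
  have cq := (contDiff_lap hψ).continuous
  have cqx := (contDiff_pdx (contDiff_lap hψ)).continuous
  have cqz := (contDiff_pdz (contDiff_lap hψ)).continuous
  have cx := (contDiff_pdx hψ).continuous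
  have cz := (contDiff_pdz hψ).continuous
  have cSx := (contDiff_pdx hS).continuous
  have cSz := (contDiff_pdz hS).continuous
  have cJ : Continuous (Jac S ψ) := (cSx.mul cz).sub (cSz.mul cx)
  set A := ∫ p in unitSq, (lap ψ p) ^ 2 with hA
  set B := ∫ p in unitSq, ((pdx (lap ψ) p) ^ 2 + (pdz (lap ψ) p) ^ 2) with hB
  set X := ∫ p in unitSq, (pdx S p) ^ 2 with hX
  set Y := ∫ p in unitSq, (pdz S p) ^ 2 with hY
  have hA0 : 0 ≤ A := integral_nonneg fun _ => by positivity
  have hB0 : 0 ≤ B := integral_nonneg fun _ => by positivity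
  have hX0 : 0 ≤ X := integral_nonneg fun _ => by positivity
  have hY0 : 0 ≤ Y := integral_nonneg fun _ => by positivity
  have hAB : A + B = ∫ p in unitSq,
      ((lap ψ p) ^ 2 + ((pdx (lap ψ) p) ^ 2 + (pdz (lap ψ) p) ^ 2)) :=
    (integral_add (integrableOn_unitSq (by fun_prop)) (integrableOn_unitSq (by fun_prop))).symm
  set K := Real.sqrt (18 * (A + B)) * C with hK
  have hKx : ∀ p ∈ unitSq, |pdx ψ p| ≤ K := fun p hp => by
    refine (abs_pdx_le hψ h0 hp).trans ?_
    rw [hK, hAB]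
    gcongr
    · exact integrableOn_unitSq (by fun_prop)
    · exact integrableOn_unitSq (by fun_prop)
    · exact measurableSet_unitSq.nullMeasurableSet
    · exact le_add_of_nonneg_left (sq_nonneg _)
  have hKz : ∀ p ∈ unitSq, |pdz ψ p| ≤ K := fun p hp => by
    refine (abs_pdz_le hψ h0 hp).trans ?_
    rw [hK, hAB]
    gcongr
    · exact integrableOn_unitSq (by fun_prop)
    · exact integrableOn_unitSq (by fun_prop)
    · exact measurableSet_unitSq.nullMeasurableSet
    · exact le_add_of_nonneg_right (sq_nonneg _)
  have hJ : ∫ p in unitSq, (Jac S ψ p) ^ 2 ≤ 2 * K ^ 2 * (X + Y) := by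
    rw [hX, hY, ← integral_add (integrableOn_unitSq (by fun_prop))
      (integrableOn_unitSq (by fun_prop)), ← integral_const_mul]
    refine setIntegral_mono_on (integrableOn_unitSq (by fun_prop))
      (integrableOn_unitSq (by fun_prop)) measurableSet_unitSq fun p hp => ?_
    have hx2 := sq_le_sq' (abs_le.1 (hKx p hp)).1 (abs_le.1 (hKx p hp)).2
    have hz2 := sq_le_sq' (abs_le.1 (hKz p hp)).1 (abs_le.1 (hKz p hp)).2
    have h1 := mul_le_mul_of_nonneg_left hz2 (sq_nonneg (pdx S p))
    have h2 := mul_le_mul_of_nonneg_left hx2 (sq_nonneg (pdz S p))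
    rw [Jac]
    nlinarith [sq_nonneg (pdx S p * pdz ψ p + pdz S p * pdx ψ p)]
  have hsq : 2 * K ^ 2 * (X + Y) = (6 * C) ^ 2 * (A + B) * (X + Y) := by
    rw [hK, mul_pow, Real.sq_sqrt (by positivity)]
    ring
  calc Real.sqrt (∫ p in unitSq, (Jac S ψ p) ^ 2)
      ≤ Real.sqrt ((6 * C) ^ 2 * (A + B) * (X + Y)) := Real.sqrt_le_sqrt (hJ.trans_eq hsq)
    _ = 6 * C * Real.sqrt (A + B) * Real.sqrt (X + Y) := by
        rw [Real.sqrt_mul (by positivity), Real.sqrt_mul (by positivity),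
          Real.sqrt_sq (by positivity)]
    _ ≤ (6 * C + 1) * (Real.sqrt A + Real.sqrt B) * (Real.sqrt X + Real.sqrt Y) := by
        gcongr
        · linarith
        · exact sqrt_add_le_sqrt_add_sqrt hA0 hB0
        · exact sqrt_add_le_sqrt_add_sqrt hX0 hY0
end
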